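/- arXiv:1312.7394 — 4 statements merged into one kernel-verified Lean document; each statement's English description precedes it below -/
import Mathlib

section
/- Let R be a commutative Noetherian ring, let Δ ∈ R, and let N be a finitely generated R-module. Write N̂ for the (Δ)-adic completion of N (the inverse limit of the modules N/ΔⁿN), write N[Δ⁻¹] for the localization of N at the powers of Δ, and write N̂[Δ⁻¹] for the localization of N̂ at the powers of Δ. Then the sequence of R-modules 0 → N → N̂ ⊕ N[Δ⁻¹] → N̂[Δ⁻¹] → 0 is exact, where the first map sends n to the pair of its canonical images and the second map sends (x, y) to the difference of the canonical images of x and y in N̂[Δ⁻¹]. Equivalently, the commutative square formed by N, N̂, N[Δ⁻¹] and N̂[Δ⁻¹] with the canonical maps is both cartesian and cocartesian in the category of R-modules. -/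
theorem aux_bdd {R : Type*} [CommRing R] [IsNoetherianRing R] (Δ : R)
    (N : Type*) [AddCommGroup N] [Module R N] [Module.Finite R N] :
    ∃ K : ℕ, ∀ (m : ℕ) (y : N), Δ ^ m • y = 0 → Δ ^ K • y = 0 := by
  have hN : IsNoetherian R N := inferInstance
  let F : ℕ →o Submodule R N :=
    { toFun := fun n => LinearMap.ker (LinearMap.lsmul R N (Δ ^ n))
      monotone' := by
        intro a b hab y hy
        simp only [LinearMap.mem_ker, LinearMap.lsmul_apply] at hy ⊢
        obtain ⟨c, rfl⟩ := Nat.exists_eq_add_of_le' hab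
        rw [pow_add, mul_smul, hy, smul_zero] }
  obtain ⟨K, hK⟩ := monotone_stabilizes_iff_noetherian.mpr hN F
  have hF : ∀ n y, y ∈ F n ↔ Δ ^ n • y = 0 := fun n y => by
    change y ∈ LinearMap.ker (LinearMap.lsmul R N (Δ ^ n)) ↔ _
    simp
  refine ⟨K, fun m y hy => ?_⟩
  rw [← hF] at hy ⊢
  rcases le_total m K with h | h
  · exact F.monotone h hy
  · rw [hK m h]; exact hy

theorem aux_mem {R : Type*} [CommRing R] (Δ : R)
    {N : Type*} [AddCommGroup N] [Module R N] (n : ℕ) (a : N) :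
    a ∈ (Ideal.span {Δ} ^ n • ⊤ : Submodule R N) ↔ ∃ b, Δ ^ n • b = a := by
  rw [Ideal.span_singleton_pow, Submodule.ideal_span_singleton_smul,
    Submodule.mem_smul_pointwise_iff_exists]
  simp

theorem aux_of {R : Type*} [CommRing R] (Δ : R)
    {N : Type*} [AddCommGroup N] [Module R N] (n : ℕ) (a : N) :
    AdicCompletion.eval (Ideal.span {Δ}) N n (AdicCompletion.of (Ideal.span {Δ}) N a) = 0 ↔
      ∃ b, Δ ^ n • b = a := by
  rw [AdicCompletion.eval_of, Submodule.mkQ_apply, Submodule.Quotient.mk_eq_zero, aux_mem]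

theorem aux_eval {R : Type*} [CommRing R] (Δ : R)
    {N : Type*} [AddCommGroup N] [Module R N] (n : ℕ) (x : AdicCompletion (Ideal.span {Δ}) N) :
    AdicCompletion.eval (Ideal.span {Δ}) N n x = 0 ↔ ∃ z, Δ ^ n • z = x := by
  rw [← aux_mem, AdicCompletion.pow_smul_top_eq_ker_eval ⟨{Δ}, by simp⟩, LinearMap.mem_ker]

theorem aux_approx {R : Type*} [CommRing R] (Δ : R)
    {N : Type*} [AddCommGroup N] [Module R N] (n : ℕ) (x : AdicCompletion (Ideal.span {Δ}) N) :
    ∃ a z, x = AdicCompletion.of (Ideal.span {Δ}) N a + Δ ^ n • z := by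
  obtain ⟨a, ha⟩ := Submodule.mkQ_surjective _ (AdicCompletion.eval (Ideal.span {Δ}) N n x)
  obtain ⟨z, hz⟩ := (aux_eval Δ n (x - AdicCompletion.of (Ideal.span {Δ}) N a)).1 (by
    rw [map_sub, AdicCompletion.eval_of, ha, sub_self])
  exact ⟨a, z, by rw [hz]; abel⟩

theorem aux_div {R : Type*} [CommRing R] (Δ : R)
    {N : Type*} [AddCommGroup N] [Module R N] (n : ℕ) (a : N)
    (h : ∃ z, Δ ^ n • z = AdicCompletion.of (Ideal.span {Δ}) N a) : ∃ b, Δ ^ n • b = a :=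
  (aux_of Δ n a).1 ((aux_eval Δ n _).2 h)

theorem aux_sep {R : Type*} [CommRing R] {Δ : R} {N : Type*} [AddCommGroup N] [Module R N]
    {K : ℕ} (hK : ∀ (m : ℕ) (y : N), Δ ^ m • y = 0 → Δ ^ K • y = 0) {k : ℕ} {u : N}
    (hu : Δ ^ k • u = 0) (h : ∃ z, Δ ^ K • z = AdicCompletion.of (Ideal.span {Δ}) N u) :
    u = 0 := by
  obtain ⟨b, rfl⟩ := aux_div Δ K u h
  rw [smul_smul, ← pow_add] at hu
  exact hK _ b hu

theorem aux_tors {R : Type*} [CommRing R] {Δ : R} {N : Type*} [AddCommGroup N] [Module R N]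
    {K : ℕ} (hK : ∀ (m : ℕ) (y : N), Δ ^ m • y = 0 → Δ ^ K • y = 0) {k : ℕ}
    {t : AdicCompletion (Ideal.span {Δ}) N} (ht : Δ ^ k • t = 0) :
    ∃ u, Δ ^ k • u = 0 ∧ AdicCompletion.of (Ideal.span {Δ}) N u = t := by
  have key : ∀ l, ∃ u, Δ ^ k • u = 0 ∧
      ∃ z, t = AdicCompletion.of (Ideal.span {Δ}) N u + Δ ^ l • z := by
    intro l
    obtain ⟨a, z, rfl⟩ := aux_approx Δ (l + k) t
    obtain ⟨b, hb⟩ := aux_div Δ (l + k) (Δ ^ k • a) ⟨- (Δ ^ k • z), by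
      rw [map_smul, smul_neg, smul_comm, neg_eq_iff_add_eq_zero, add_comm, ← smul_add, ht]⟩
    refine ⟨a - Δ ^ l • b, ?_, AdicCompletion.of (Ideal.span {Δ}) N b + Δ ^ k • z, ?_⟩
    · rw [smul_sub, smul_smul, ← pow_add, add_comm k l, hb, sub_self]
    · rw [map_sub, map_smul, smul_add, smul_smul, ← pow_add]; abel
  obtain ⟨u, hu, z, hz⟩ := key K
  refine ⟨u, hu, ?_⟩
  rw [eq_comm, ← sub_eq_zero]
  ext l
  rw [AdicCompletion.val_zero_apply, ← AdicCompletion.eval_apply]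
  rw [aux_eval]
  obtain ⟨v, hv, w, hw⟩ := key (l + K)
  have : v - u = 0 := aux_sep hK (k := k) (by rw [smul_sub, hv, hu, sub_zero])
    ⟨z - Δ ^ l • w, by
      rw [smul_sub, smul_smul, ← pow_add, add_comm K l, map_sub, sub_eq_sub_iff_add_eq_add,
        add_comm, ← hz, hw]⟩
  rw [sub_eq_zero] at this
  subst this
  exact ⟨Δ ^ K • w, by rw [smul_smul, ← pow_add]; exact (sub_eq_of_eq_add' hw).symm⟩

/-- Let `R` be a commutative Noetherian ring, `Δ ∈ R`, and `N` a finitely generated `R`-module.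
Then the sequence `0 → N → N̂ ⊕ N[Δ⁻¹] → N̂[Δ⁻¹] → 0` is exact, where `N̂` is the `(Δ)`-adic
completion of `N`, `N[Δ⁻¹]` is the localization at the powers of `Δ`, the first map is the pair
of canonical maps and the second is the difference of the two canonical maps to the localized
completion. Equivalently, the evident square is bicartesian. -/
theorem artin_rees_patching_square
    (R : Type*) [CommRing R] [IsNoetherianRing R] (Δ : R)
    (N : Type*) [AddCommGroup N] [Module R N] [Module.Finite R N] :
    letI I : Ideal R := Ideal.span {Δ}
    letI S : Submonoid R := Submonoid.powers Δ
    letI f : N →ₗ[R] AdicCompletion I N × LocalizedModule S N :=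
      LinearMap.prod (AdicCompletion.of I N) (LocalizedModule.mkLinearMap S N)
    letI g : AdicCompletion I N × LocalizedModule S N →ₗ[R]
        LocalizedModule S (AdicCompletion I N) :=
      (LocalizedModule.mkLinearMap S (AdicCompletion I N)).comp
          (LinearMap.fst R (AdicCompletion I N) (LocalizedModule S N)) -
        (IsLocalizedModule.map S (LocalizedModule.mkLinearMap S N)
            (LocalizedModule.mkLinearMap S (AdicCompletion I N))
            (AdicCompletion.of I N)).comp
          (LinearMap.snd R (AdicCompletion I N) (LocalizedModule S N))
    Function.Injective f ∧ Function.Exact f g ∧ Function.Surjective g := by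
  let I : Ideal R := Ideal.span {Δ}
  let S : Submonoid R := Submonoid.powers Δ
  let f : N →ₗ[R] AdicCompletion I N × LocalizedModule S N :=
    LinearMap.prod (AdicCompletion.of I N) (LocalizedModule.mkLinearMap S N)
  let g : AdicCompletion I N × LocalizedModule S N →ₗ[R]
      LocalizedModule S (AdicCompletion I N) :=
    (LocalizedModule.mkLinearMap S (AdicCompletion I N)).comp
        (LinearMap.fst R (AdicCompletion I N) (LocalizedModule S N)) -
      (IsLocalizedModule.map S (LocalizedModule.mkLinearMap S N)
          (LocalizedModule.mkLinearMap S (AdicCompletion I N))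
          (AdicCompletion.of I N)).comp
        (LinearMap.snd R (AdicCompletion I N) (LocalizedModule S N))
  change Function.Injective f ∧ Function.Exact f g ∧ Function.Surjective g
  obtain ⟨K, hK⟩ := aux_bdd Δ N
  have hg : ∀ x n s, g (x, LocalizedModule.mk n s) =
      LocalizedModule.mk x 1 - LocalizedModule.mk (AdicCompletion.of I N n) s := by
    intro x n s
    simp only [g, LinearMap.sub_apply, LinearMap.comp_apply, LinearMap.fst_apply,
      LinearMap.snd_apply, IsLocalizedModule.map_LocalizedModules,
      LocalizedModule.mkLinearMap_apply]
  refine ⟨?_, ?_, ?_⟩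
  · rw [injective_iff_map_eq_zero]
    intro n hn
    have h1 : AdicCompletion.of I N n = 0 := congrArg Prod.fst hn
    have h2 : LocalizedModule.mkLinearMap S N n = 0 := congrArg Prod.snd hn
    rw [IsLocalizedModule.eq_zero_iff S] at h2
    obtain ⟨⟨_, k, rfl⟩, hs⟩ := h2
    exact aux_sep hK (k := k) hs ⟨0, by rw [smul_zero]; exact h1.symm⟩
  · rintro ⟨x, y⟩
    constructor
    · induction y using LocalizedModule.induction_on with
      | h n s =>
        intro h
        rw [hg, sub_eq_zero, LocalizedModule.mk_eq] at h
        obtain ⟨⟨_, k, rfl⟩, rfl⟩ : ∃ s' : S, s' = s := ⟨s, rfl⟩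
        obtain ⟨⟨_, j, rfl⟩, h⟩ := h
        replace h : Δ ^ j • Δ ^ k • x = Δ ^ j • (1 : R) • AdicCompletion.of I N n := h
        rw [one_smul, smul_smul, ← pow_add, ← map_smul] at h
        obtain ⟨m, hm⟩ := aux_div Δ (j + k) _ ⟨x, h⟩
        obtain ⟨u, hu, hu'⟩ := aux_tors hK (k := j + k) (t := x - AdicCompletion.of I N m) (by
          rw [smul_sub, h, ← map_smul, hm, sub_self])
        refine ⟨m + u, Prod.ext ?_ ?_⟩
        · change AdicCompletion.of I N (m + u) = x
          rw [map_add]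
          exact (congrArg _ hu').trans (by abel)
        · change LocalizedModule.mk (m + u) 1 = LocalizedModule.mk n _
          rw [LocalizedModule.mk_eq]
          refine ⟨⟨Δ ^ j, j, rfl⟩, ?_⟩
          change Δ ^ j • Δ ^ k • (m + u) = Δ ^ j • (1 : R) • n
          rw [one_smul, smul_smul, ← pow_add, smul_add, hu, hm, add_zero]
    · rintro ⟨n, hn⟩
      rw [← hn]
      change g (AdicCompletion.of I N n, LocalizedModule.mk n 1) = 0
      rw [hg, sub_self]
  · intro y
    induction y using LocalizedModule.induction_on with
    | h x s =>
      obtain ⟨⟨_, k, rfl⟩, rfl⟩ : ∃ s' : S, s' = s := ⟨s, rfl⟩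
      obtain ⟨a, z, hz⟩ := aux_approx Δ k x
      refine ⟨(z, LocalizedModule.mk (-a) ⟨Δ ^ k, k, rfl⟩), ?_⟩
      rw [hg, map_neg, LocalizedModule.mk_neg, sub_neg_eq_add, LocalizedModule.mk_add_mk, one_mul,
        one_smul, hz, add_comm]
      rfl
end

section
/- Let p be a prime number and let 0 → A → B → C → 0 be a short exact sequence of abelian groups such that C has no p-torsion (multiplication by p is injective on C). Then the induced sequence of p-adic completions 0 → Â → B̂ → Ĉ → 0 is exact, where for an abelian group M the p-adic completion M̂ is the inverse limit of the quotients M/pⁿM, and the maps are those induced functorially by the given ones. -/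
theorem aux_mem_iff (p : ℕ) {M : Type*} [AddCommGroup M] (n : ℕ) (x : M) :
    x ∈ ((Ideal.span {(p : ℤ)}) ^ n • ⊤ : Submodule ℤ M) ↔ ∃ y : M, ((p : ℤ) ^ n) • y = x := by
  rw [Ideal.span_singleton_pow, Submodule.ideal_span_singleton_smul,
    Submodule.mem_smul_pointwise_iff_exists]
  simp

theorem aux_pow_inj (p : ℕ) {C : Type*} [AddCommGroup C]
    (hC : Function.Injective fun c : C => (p : ℤ) • c) (n : ℕ) (c : C)
    (h : ((p : ℤ) ^ n) • c = 0) : c = 0 := by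
  induction n with
  | zero => simpa using h
  | succ n ih =>
    apply ih
    apply hC
    simp only [smul_zero]
    rw [← mul_smul, ← pow_succ', h]

/-- Let `p` be a prime and `0 → A → B → C → 0` a short exact sequence of abelian groups
(ℤ-modules) such that multiplication by `p` is injective on `C` (`C` has no `p`-torsion).
Then the induced sequence of `p`-adic completions `0 → Â → B̂ → Ĉ → 0` is exact, where the
`p`-adic completion of `M` is the inverse limit of the quotients `M/pⁿM`. -/
theorem padic_completion_exact_of_torsionFree_cokernel
    (p : ℕ) (hp : p.Prime)
    (A B C : Type*) [AddCommGroup A] [AddCommGroup B] [AddCommGroup C]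
    (f : A →ₗ[ℤ] B) (g : B →ₗ[ℤ] C)
    (hf : Function.Injective f) (hfg : Function.Exact f g) (hg : Function.Surjective g)
    (hC : Function.Injective fun c : C => (p : ℤ) • c) :
    letI I : Ideal ℤ := Ideal.span {(p : ℤ)}
    Function.Injective (AdicCompletion.map I f) ∧
      Function.Exact (AdicCompletion.map I f) (AdicCompletion.map I g) ∧
        Function.Surjective (AdicCompletion.map I g) := by
  set I : Ideal ℤ := Ideal.span {(p : ℤ)} with hI
  have key : ∀ (n : ℕ) (a : A), f a ∈ (I ^ n • ⊤ : Submodule ℤ B) →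
      a ∈ (I ^ n • ⊤ : Submodule ℤ A) := by
    intro n a ha
    obtain ⟨b, hb⟩ := (aux_mem_iff p n _).1 ha
    have hgb : g b = 0 := by
      apply aux_pow_inj p hC n
      rw [← map_smul, hb]
      exact hfg.apply_apply_eq_zero a
    obtain ⟨a', rfl⟩ := (hfg b).1 hgb
    refine (aux_mem_iff p n _).2 ⟨a', hf ?_⟩
    rw [map_smul, hb]
  have lift : ∀ (n : ℕ) (b : B), g b ∈ (I ^ n • ⊤ : Submodule ℤ C) →
      ∃ a : A, f a - b ∈ (I ^ n • ⊤ : Submodule ℤ B) := by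
    intro n b hb
    obtain ⟨c, hc⟩ := (aux_mem_iff p n _).1 hb
    obtain ⟨b', rfl⟩ := hg c
    obtain ⟨a, ha⟩ := (hfg (b - ((p : ℤ) ^ n) • b')).1 (by rw [map_sub, map_smul, hc, sub_self])
    refine ⟨a, (aux_mem_iff p n _).2 ⟨-b', ?_⟩⟩
    rw [ha, smul_neg]
    abel
  refine ⟨?_, ?_, ?_⟩
  · rw [injective_iff_map_eq_zero]
    intro x
    apply AdicCompletion.induction_on I A x (fun a ↦ ?_)
    intro hx
    refine AdicCompletion.mk_zero_of _ _ _ ⟨0, fun n _ ↦ ⟨n, le_rfl, n, le_rfl, key n _ ?_⟩⟩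
    simpa using congrArg (fun x ↦ x.val n) hx
  · refine LinearMap.exact_of_comp_eq_zero_of_ker_le_range ?_ (fun y ↦ ?_)
    · rw [AdicCompletion.map_comp, hfg.linearMap_comp_eq_zero, AdicCompletion.map_zero]
    · apply AdicCompletion.induction_on I B y (fun b ↦ ?_)
      intro hz
      have hb (n : ℕ) : g (b n) ∈ (I ^ n • ⊤ : Submodule ℤ C) := by
        simpa using congrArg (fun x ↦ x.val n) hz
      choose a ha using fun n ↦ lift n (b n) (hb n)
      refine ⟨AdicCompletion.mk I A (AdicCompletion.AdicCauchySequence.mk I A a ?_), ?_⟩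
      · intro n
        rw [SModEq.sub_mem]
        apply key
        have h1 : f (a (n + 1)) - b (n + 1) ∈ (I ^ n • ⊤ : Submodule ℤ B) :=
          Submodule.smul_mono_left (Ideal.pow_le_pow_right (Nat.le_succ n)) (ha (n + 1))
        have h2 : b n - b (n + 1) ∈ (I ^ n • ⊤ : Submodule ℤ B) :=
          SModEq.sub_mem.1 (b.property (Nat.le_succ n))
        have h3 := Submodule.add_mem _ (Submodule.sub_mem _ (ha n) h1) h2
        convert h3 using 1
        rw [map_sub]
        abel
      · ext n
        exact (Submodule.Quotient.eq _).2 (ha n)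
  · exact AdicCompletion.map_surjective I hg
end

section
/- Let G be a finitely generated abelian group whose quotient by its torsion subgroup is infinite cyclic. Let Q ⊆ G be a submonoid (containing 0 and closed under addition) such that (i) Q generates G as a group, and (ii) Q is saturated: for every g ∈ G and every positive integer k, if k·g ∈ Q then g ∈ Q. Then either Q = G, or there exists a surjective group homomorphism φ : G → ℤ such that Q = { g ∈ G : φ(g) ≥ 0 }. -/
theorem aux_nonneg_mem {G : Type*} [AddCommGroup G] (Q : AddSubmonoid G)
    (hsat : ∀ (g : G) (k : ℕ), 0 < k → k • g ∈ Q → g ∈ Q)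
    (ψ : G →+ ℤ) (hker : ∀ g, ψ g = 0 → g ∈ Q) (q : G) (hq : q ∈ Q) (hpos : 0 < ψ q)
    (g : G) (hg : 0 ≤ ψ g) : g ∈ Q := by
  obtain ⟨a, ha⟩ := Int.eq_ofNat_of_zero_le hpos.le
  obtain ⟨b, hb⟩ := Int.eq_ofNat_of_zero_le hg
  apply hsat g a (by omega)
  have h1 : a • g - b • q ∈ Q := by
    apply hker
    rw [map_sub, map_nsmul, map_nsmul, ha, hb]
    simp [mul_comm]
  have h2 := Q.add_mem h1 (Q.nsmul_mem hq b)
  simpa using h2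

/-- Let `G` be a finitely generated abelian group whose quotient by its torsion subgroup is
infinite cyclic, and let `Q ⊆ G` be a submonoid generating `G` as a group which is saturated:
`k • g ∈ Q` for some `k > 0` implies `g ∈ Q`. Then either `Q = G`, or there is a surjective
homomorphism `φ : G → ℤ` with `Q = {g : φ g ≥ 0}`. -/
theorem saturated_submonoid_of_rank_one_group
    (G : Type*) [AddCommGroup G] [AddGroup.FG G]
    (hG : Nonempty ((G ⧸ AddCommGroup.torsion G) ≃+ ℤ))
    (Q : AddSubmonoid G)
    (hgen : AddSubgroup.closure (Q : Set G) = ⊤)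
    (hsat : ∀ (g : G) (k : ℕ), 0 < k → k • g ∈ Q → g ∈ Q) :
    Q = ⊤ ∨ ∃ φ : G →+ ℤ, Function.Surjective φ ∧ ∀ g : G, g ∈ Q ↔ 0 ≤ φ g := by
  obtain ⟨e⟩ := hG
  let φ : G →+ ℤ := e.toAddMonoidHom.comp (QuotientAddGroup.mk' (AddCommGroup.torsion G))
  have hsurj : Function.Surjective φ :=
    e.surjective.comp (QuotientAddGroup.mk'_surjective _)
  have hker : ∀ g, φ g = 0 → g ∈ Q := by
    intro g hg
    have h1 : (QuotientAddGroup.mk' (AddCommGroup.torsion G)) g = 0 :=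
      e.injective (by rw [map_zero]; exact hg)
    have h2 : g ∈ AddCommGroup.torsion G := by
      simpa [QuotientAddGroup.eq_zero_iff] using h1
    have h3 : IsOfFinAddOrder g := h2
    obtain ⟨n, hn, h⟩ := isOfFinAddOrder_iff_nsmul_eq_zero.1 h3
    exact hsat g n hn (h ▸ Q.zero_mem)
  have hker' : ∀ g, (-φ) g = 0 → g ∈ Q := fun g hg => hker g (by simpa using hg)
  by_cases hp : ∃ q ∈ Q, 0 < φ q
  · obtain ⟨q, hq, hqp⟩ := hp
    have A := aux_nonneg_mem Q hsat φ hker q hq hqp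
    by_cases hn : ∃ q ∈ Q, φ q < 0
    · obtain ⟨r, hr, hrn⟩ := hn
      have B := aux_nonneg_mem Q hsat (-φ) hker' r hr (by simpa using hrn)
      left
      refine eq_top_iff.2 fun g _ => ?_
      rcases le_total 0 (φ g) with h | h
      · exact A g h
      · exact B g (by simpa using h)
    · right
      push Not at hn
      exact ⟨φ, hsurj, fun g => ⟨hn g, A g⟩⟩
  · push Not at hp
    by_cases hn : ∃ q ∈ Q, φ q < 0
    · obtain ⟨r, hr, hrn⟩ := hn
      have B := aux_nonneg_mem Q hsat (-φ) hker' r hr (by simpa using hrn)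
      right
      refine ⟨-φ, fun z => ?_, fun g => ⟨fun h => by simpa using hp g h, B g⟩⟩
      obtain ⟨g, hg⟩ := hsurj (-z)
      exact ⟨g, by simp [hg]⟩
    · push Not at hn
      exfalso
      have h : AddSubgroup.closure (Q : Set G) ≤ φ.ker :=
        (AddSubgroup.closure_le _).2 fun g hg => le_antisymm (hp g hg) (hn g hg)
      obtain ⟨g, hg⟩ := hsurj 1
      have h0 : φ g = 0 := h (hgen ▸ AddSubgroup.mem_top g)
      omega
end

section
/- Let S be a commutative ring, I an ideal of S, and suppose S is I-adically complete (and separated), i.e. the canonical map from S to the inverse limit of the quotients S/Iⁿ is an isomorphism. Let m be a positive integer whose image in S is a unit. Then reduction modulo I induces a bijection between the set of m-th roots of unity of S, { x ∈ S : xᵐ = 1 }, and the set of m-th roots of unity of S/I, { y ∈ S/I : yᵐ = 1 }. -/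
/-- Let `S` be a commutative ring which is complete and separated with respect to the `I`-adic
topology for an ideal `I`, and let `m` be a positive integer whose image in `S` is a unit.
Then reduction modulo `I` gives a bijection between the `m`-th roots of unity of `S` and the
`m`-th roots of unity of `S/I`. -/
theorem roots_of_unity_lift_adic_complete
    (S : Type*) [CommRing S] (I : Ideal S) [IsAdicComplete I S]
    (m : ℕ) (hm : 0 < m) (hmu : IsUnit (m : S)) :
    Set.BijOn (Ideal.Quotient.mk I) {x : S | x ^ m = 1} {y : S ⧸ I | y ^ m = 1} := by
  have hloc : IsLocalHom (Ideal.Quotient.mk I) :=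
    isLocalHom_of_le_jacobson_bot I (IsAdicComplete.le_jacobson_bot I)
  have hmQ : IsUnit (m : S ⧸ I) := by
    have := hmu.map (Ideal.Quotient.mk I)
    rwa [map_natCast] at this
  refine ⟨?_, ?_, ?_⟩
  · intro x hx
    simp only [Set.mem_setOf_eq] at hx ⊢
    rw [← map_pow, hx, map_one]
  · intro x hx y hy hxy
    simp only [Set.mem_setOf_eq] at hx hy
    have hxu : IsUnit x := IsUnit.of_pow_eq_one hx hm.ne'
    have h := (Commute.all x y).geom_sum₂_mul m
    rw [hx, hy, sub_self] at h
    have hu : IsUnit (∑ i ∈ Finset.range m, x ^ i * y ^ (m - 1 - i)) := by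
      apply isUnit_of_map_unit (Ideal.Quotient.mk I)
      rw [RingHom.map_geom_sum₂, ← hxy, geom_sum₂_self]
      exact hmQ.mul ((hxu.map _).pow _)
    exact sub_eq_zero.mp (hu.mul_right_eq_zero.mp h)
  · intro y hy
    simp only [Set.mem_setOf_eq] at hy
    obtain ⟨a, rfl⟩ := Ideal.Quotient.mk_surjective y
    have hau : IsUnit (Ideal.Quotient.mk I a) := IsUnit.of_pow_eq_one hy hm.ne'
    obtain ⟨b, hb, hba⟩ := HenselianRing.is_henselian (I := I)
      (Polynomial.X ^ m - Polynomial.C (1 : S)) (Polynomial.monic_X_pow_sub_C 1 hm.ne') a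
      (by
        rw [← Ideal.Quotient.eq_zero_iff_mem]
        simp [hy])
      (by
        simp only [Polynomial.derivative_sub, Polynomial.derivative_X_pow,
          Polynomial.derivative_C, sub_zero, Polynomial.eval_mul, Polynomial.eval_C,
          Polynomial.eval_pow, Polynomial.eval_X, map_mul, map_pow, map_natCast]
        exact (by simpa using hmQ.mul (hau.pow _)))
    refine ⟨b, ?_, Ideal.Quotient.eq.mpr hba⟩
    simpa [Polynomial.IsRoot, sub_eq_zero] using hb
end
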